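/- arXiv:1603.06022 — 2 statements merged into one kernel-verified Lean document; each statement's English description precedes it below -/
import Mathlib

section
/- Let γ ≥ 0, 0 < β ≤ 1, 0 < τ ≤ 1 with 0 ≤ β − τ < 1, and let υ be a positive integer. Then for every real z with 0 < z < 1, 𝔗^{β,τ,γ}{z^υ} = ((γ+1)^{β−τ} Γ((υ+β−1)/(γ+1)+1) Γ(τ)) / (Γ((υ+β−1)/(γ+1)+1−β+τ) Γ(β)) · z^{(1−β+τ)γ+υ}; that is, the function F(z) = ∫₀^z ζ^{γ+β+υ−1} (z^{γ+1} − ζ^{γ+1})^{τ−β} dζ is differentiable at z and ((γ+1)^{β−τ} Γ(τ))/(Γ(β)Γ(1−β+τ)) · z^{1−τ} · F′(z) equals the stated right-hand side. -/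
/-- The Beta integral over `[0, a]`, in terms of the real Gamma function. -/
lemma integral_rpow_mul_sub_rpow {s t a : ℝ} (hs : 0 < s) (ht : 0 < t) (ha : 0 < a) :
    ∫ y in (0:ℝ)..a, y ^ (s - 1) * (a - y) ^ (t - 1) =
      a ^ (s + t - 1) * (Real.Gamma s * Real.Gamma t / Real.Gamma (s + t)) := by
  have h := Complex.betaIntegral_scaled (s : ℂ) (t : ℂ) ha
  rw [Complex.betaIntegral_eq_Gamma_mul_div _ _ (by simpa using hs) (by simpa using ht)] at h
  have hcongr : ∫ y in (0:ℝ)..a, (y : ℂ) ^ ((s : ℂ) - 1) * ((a : ℂ) - y) ^ ((t : ℂ) - 1) =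
      ∫ y in (0:ℝ)..a, ((y ^ (s - 1) * (a - y) ^ (t - 1) : ℝ) : ℂ) := by
    refine intervalIntegral.integral_congr fun y hy => ?_
    rw [Set.uIcc_of_le ha.le] at hy
    simp only [Complex.ofReal_mul, Complex.ofReal_cpow hy.1,
      Complex.ofReal_cpow (sub_nonneg.2 hy.2), Complex.ofReal_sub, Complex.ofReal_one]
  rw [hcongr, intervalIntegral.integral_ofReal] at h
  apply Complex.ofReal_injective
  rw [h, Complex.ofReal_mul, Complex.ofReal_cpow ha.le, Complex.ofReal_div, Complex.ofReal_mul,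
    ← Complex.Gamma_ofReal, ← Complex.Gamma_ofReal, ← Complex.Gamma_ofReal]
  push_cast
  rfl

/-- The Erdélyi–Kober type Beta integral, in terms of the real Gamma function. -/
lemma integral_rpow_mul_rpow_sub_rpow {g p q x : ℝ} (hg : 0 < g) (hp : 0 < p + 1)
    (hq : 0 < q + 1) (hx : 0 < x) :
    ∫ ζ in (0:ℝ)..x, ζ ^ p * (x ^ g - ζ ^ g) ^ q =
      x ^ (p + 1 + g * q) * (g⁻¹ * (Real.Gamma ((p + 1) / g) * Real.Gamma (q + 1) /
        Real.Gamma ((p + 1) / g + q + 1))) := by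
  have hxg : 0 < x ^ g := Real.rpow_pos_of_pos hx g
  have hbeta := integral_rpow_mul_sub_rpow (div_pos hp hg) hq hxg
  rw [intervalIntegral.integral_of_le hxg.le, ← MeasureTheory.integral_indicator measurableSet_Ioc,
    ← MeasureTheory.setIntegral_eq_integral_of_forall_compl_eq_zero (s := Set.Ioi 0)
      (fun y hy => Set.indicator_of_notMem (fun h => hy h.1) _),
    ← MeasureTheory.integral_comp_rpow_Ioi_of_pos hg] at hbeta
  have hsubst : ∫ ζ in (0:ℝ)..x, g * (ζ ^ p * (x ^ g - ζ ^ g) ^ q) =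
      ∫ ζ in Set.Ioi (0:ℝ), (g * ζ ^ (g - 1)) • (Set.Ioc 0 (x ^ g)).indicator
        (fun y => y ^ ((p + 1) / g - 1) * (x ^ g - y) ^ (q + 1 - 1)) (ζ ^ g) := by
    rw [intervalIntegral.integral_of_le hx.le,
      ← MeasureTheory.integral_indicator measurableSet_Ioc,
      ← MeasureTheory.setIntegral_eq_integral_of_forall_compl_eq_zero (s := Set.Ioi 0)
        (fun y hy => Set.indicator_of_notMem (fun h => hy h.1) _)]
    refine MeasureTheory.setIntegral_congr_fun measurableSet_Ioi fun ζ hζ => ?_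
    have hζ : 0 < ζ := hζ
    have hζg : 0 < ζ ^ g := Real.rpow_pos_of_pos hζ g
    by_cases h : ζ ≤ x
    · have h' : ζ ^ g ≤ x ^ g := Real.rpow_le_rpow hζ.le h hg.le
      have hpow : ζ ^ p = ζ ^ (g - 1) * (ζ ^ g) ^ ((p + 1) / g - 1) := by
        rw [← Real.rpow_mul hζ.le, ← Real.rpow_add hζ]
        congr 1
        field_simp
        ring
      simp only [Set.indicator_of_mem (show ζ ∈ Set.Ioc 0 x from ⟨hζ, h⟩),
        Set.indicator_of_mem (show ζ ^ g ∈ Set.Ioc 0 (x ^ g) from ⟨hζg, h'⟩), smul_eq_mul,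
        add_sub_cancel_right, hpow]
      ring
    · have h' : ¬ ζ ^ g ≤ x ^ g := (Real.rpow_lt_rpow hx.le (not_le.1 h) hg).not_ge
      simp only [Set.indicator_of_notMem (fun hm : ζ ∈ Set.Ioc 0 x => h hm.2),
        Set.indicator_of_notMem (fun hm : ζ ^ g ∈ Set.Ioc 0 (x ^ g) => h' hm.2), smul_zero]
  rw [← hsubst, intervalIntegral.integral_const_mul, ← Real.rpow_mul hx.le, ← add_assoc] at hbeta
  have hexp : g * ((p + 1) / g + q + 1 - 1) = p + 1 + g * q := by
    field_simp
    ring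
  rw [hexp] at hbeta
  rw [mul_left_comm, ← hbeta, inv_mul_cancel_left₀ hg.ne']

/-- The generalized Tremblay fractional differential operator applied to the monomial `z ^ υ`. -/
theorem tremblay_monomial (γ β τ : ℝ) (hγ : 0 ≤ γ)
    (hβ0 : 0 < β) (hβ1 : β ≤ 1) (hτ0 : 0 < τ) (hτ1 : τ ≤ 1)
    (hβτ0 : 0 ≤ β - τ) (hβτ1 : β - τ < 1)
    (υ : ℕ) (hυ : 0 < υ) (z : ℝ) (hz0 : 0 < z) (hz1 : z < 1) :
    ∃ F' : ℝ,
      HasDerivAt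
        (fun x : ℝ => ∫ ζ in (0:ℝ)..x,
          ζ ^ (γ + β + (υ : ℝ) - 1) * (x ^ (γ + 1) - ζ ^ (γ + 1)) ^ (τ - β)) F' z ∧
      ((γ + 1) ^ (β - τ) * Real.Gamma τ) / (Real.Gamma β * Real.Gamma (1 - β + τ)) *
          z ^ (1 - τ) * F' =
        ((γ + 1) ^ (β - τ) * Real.Gamma (((υ : ℝ) + β - 1) / (γ + 1) + 1) * Real.Gamma τ) /
            (Real.Gamma (((υ : ℝ) + β - 1) / (γ + 1) + 1 - β + τ) * Real.Gamma β) *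
          z ^ ((1 - β + τ) * γ + (υ : ℝ)) := by
  have hυ1 : (1 : ℝ) ≤ υ := by exact_mod_cast hυ
  have hg : 0 < γ + 1 := by linarith
  set s : ℝ := ((υ : ℝ) + β - 1) / (γ + 1) + 1 with hs
  have hs_eq : (γ + β + (υ : ℝ) - 1 + 1) / (γ + 1) = s := by
    rw [hs]
    field_simp
    ring
  have hs1 : 0 < s - 1 := by
    rw [hs, add_sub_cancel_right]
    exact div_pos (by linarith) hg
  set e : ℝ := γ + β + (υ : ℝ) - 1 + 1 + (γ + 1) * (τ - β) with he
  have he_eq : e = (γ + 1) * (s - β + τ) := by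
    rw [he, hs]
    field_simp
    ring
  set C : ℝ := (γ + 1)⁻¹ * (Real.Gamma s * Real.Gamma (1 - β + τ) /
    Real.Gamma (s - β + τ + 1)) with hC
  refine ⟨e * z ^ (e - 1) * C, ?_, ?_⟩
  · refine ((Real.hasDerivAt_rpow_const (Or.inl hz0.ne')).mul_const C).congr_of_eventuallyEq ?_
    filter_upwards [lt_mem_nhds hz0] with x hx
    rw [integral_rpow_mul_rpow_sub_rpow hg (by linarith) (by linarith) hx, hs_eq, hC,
      show τ - β + 1 = 1 - β + τ by ring, show s + (τ - β) + 1 = s - β + τ + 1 by ring]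
  · have hr : 0 < s - β + τ := by linarith
    have hz : z ^ ((1 - β + τ) * γ + (υ : ℝ)) = z ^ (1 - τ) * z ^ (e - 1) := by
      rw [← Real.rpow_add hz0]
      congr 1
      rw [he]
      ring
    have h1 := (Real.Gamma_pos_of_pos hr).ne'
    have h2 := (Real.Gamma_pos_of_pos hβ0).ne'
    have h3 := (Real.Gamma_pos_of_pos (show 0 < 1 - β + τ by linarith)).ne'
    rw [hz, hC, Real.Gamma_add_one hr.ne', he_eq]
    generalize z ^ ((γ + 1) * (s - β + τ) - 1) = w
    have hr' := hr.ne'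
    have hg' := hg.ne'
    generalize s - β + τ = r at *
    generalize 1 - β + τ = c at *
    field_simp
end

section
/- Let γ ≥ 0, 0 < β ≤ 1, 0 < τ ≤ 1 with 0 ≤ β − τ < 1. For the function f(t) = t(1−t)^{−1} and every real z with 0 < z < 1, 𝔗^{β,τ,γ}f(z) = ((γ+1)^{β−τ} Γ(τ))/Γ(β) · z^{(1−β+τ)γ} · Σ_{κ=1}^∞ [Γ((κ+β−1)/(γ+1)+1)] / [Γ((κ+β−1)/(γ+1)+1−β+τ)] · z^κ. -/
open MeasureTheory Set

/-- Euler's beta integral over the reals. -/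
theorem integral_Ioo_rpow_mul_one_sub_rpow {a b : ℝ} (ha : 0 < a) (hb : 0 < b) :
    ∫ t in Ioo (0 : ℝ) 1, t ^ (a - 1) * (1 - t) ^ (b - 1) = ProbabilityTheory.beta a b := by
  rw [ProbabilityTheory.beta_eq_betaIntegralReal a b ha hb, Complex.betaIntegral,
    intervalIntegral.integral_of_le zero_le_one, integral_Ioc_eq_integral_Ioo]
  have h : ∫ t in Ioo (0 : ℝ) 1, ((t : ℂ) ^ ((a : ℂ) - 1) * (1 - (t : ℂ)) ^ ((b : ℂ) - 1)) =
      ∫ t in Ioo (0 : ℝ) 1, ((t ^ (a - 1) * (1 - t) ^ (b - 1) : ℝ) : ℂ) := by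
    refine setIntegral_congr_fun measurableSet_Ioo fun t ht => ?_
    have h1 : 0 ≤ 1 - t := by linarith [ht.2]
    push_cast [Complex.ofReal_cpow ht.1.le, Complex.ofReal_cpow h1]
    rfl
  rw [h, integral_complex_ofReal, Complex.ofReal_re]

theorem integral_Ioo_rpow_mul_one_sub_rpow_rpow {p b m : ℝ} (hp : 0 < p) (hb : 0 < b)
    (hm : -1 < m) :
    ∫ u in Ioo (0 : ℝ) 1, u ^ m * (1 - u ^ p) ^ (b - 1) =
      p⁻¹ * ProbabilityTheory.beta ((m + 1) / p) b := by
  have ha : 0 < (m + 1) / p := div_pos (by linarith) hp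
  rw [← integral_Ioo_rpow_mul_one_sub_rpow ha hb]
  have hI : ∀ f : ℝ → ℝ, ∫ u in Ioo (0 : ℝ) 1, f u =
      ∫ u in Ioi (0 : ℝ), (Iio (1 : ℝ)).indicator f u := fun f => by
    rw [setIntegral_indicator measurableSet_Iio, Ioi_inter_Iio]
  rw [hI, hI, ← integral_comp_rpow_Ioi_of_pos (g := (Iio (1 : ℝ)).indicator fun t : ℝ =>
    t ^ ((m + 1) / p - 1) * (1 - t) ^ (b - 1)) hp, ← integral_const_mul]
  refine setIntegral_congr_fun measurableSet_Ioi fun u (hu : 0 < u) => ?_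
  have hlt : u ^ p < 1 ↔ u < 1 := by
    rw [← Real.one_rpow p, Real.rpow_lt_rpow_iff hu.le zero_le_one hp, Real.one_rpow]
  by_cases h : u < 1
  · simp only [indicator, mem_Iio, h, hlt.2 h, if_true, smul_eq_mul]
    rw [← Real.rpow_mul hu.le]
    have : u ^ m = u ^ (p - 1) * u ^ (p * ((m + 1) / p - 1)) := by
      rw [← Real.rpow_add hu]
      congr 1
      field_simp
      ring
    rw [this]
    field_simp
  · simp [indicator, h, hlt]

theorem integrableOn_Ioo_rpow_mul_one_sub_rpow_rpow {p b m : ℝ} (hp : 0 < p) (hb : 0 < b)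
    (hm : -1 < m) :
    IntegrableOn (fun u : ℝ => u ^ m * (1 - u ^ p) ^ (b - 1)) (Ioo 0 1) := by
  by_contra h
  have h0 := integral_undef h
  rw [integral_Ioo_rpow_mul_one_sub_rpow_rpow hp hb hm] at h0
  have := ProbabilityTheory.beta_pos (div_pos (by linarith : 0 < m + 1) hp) hb
  have : 0 < p⁻¹ * ProbabilityTheory.beta ((m + 1) / p) b := by positivity
  exact this.ne' h0

theorem beta_coeff_bounds {p b m : ℝ} (hp : 0 < p) (hb : 0 < b) (hm : -1 < m) (n : ℕ) :
    0 ≤ p⁻¹ * ProbabilityTheory.beta ((m + n + 1) / p) b ∧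
    p⁻¹ * ProbabilityTheory.beta ((m + n + 1) / p) b ≤
      p⁻¹ * ProbabilityTheory.beta ((m + 1) / p) b := by
  have hn : -1 < m + n := by linarith [n.cast_nonneg (α := ℝ)]
  refine ⟨?_, ?_⟩
  · have := ProbabilityTheory.beta_pos (div_pos (by linarith : 0 < m + n + 1) hp) hb
    positivity
  · rw [← integral_Ioo_rpow_mul_one_sub_rpow_rpow hp hb hm,
      ← integral_Ioo_rpow_mul_one_sub_rpow_rpow hp hb hn]
    refine setIntegral_mono_on (integrableOn_Ioo_rpow_mul_one_sub_rpow_rpow hp hb hn)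
      (integrableOn_Ioo_rpow_mul_one_sub_rpow_rpow hp hb hm) measurableSet_Ioo fun u hu => ?_
    have h1 : 0 ≤ 1 - u ^ p := sub_nonneg.2 (Real.rpow_le_one hu.1.le hu.2.le hp.le)
    refine mul_le_mul_of_nonneg_right ?_ (Real.rpow_nonneg h1 _)
    exact Real.rpow_le_rpow_of_exponent_ge hu.1 hu.2.le (by linarith [n.cast_nonneg (α := ℝ)])

/-- Power series expansion of the fractional integral of `t ^ m / (1 - t)`. -/
theorem integral_rpow_div_one_sub_mul_rpow_sub_rpow {p b m x : ℝ} (hp : 0 < p) (hb : 0 < b)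
    (hm : -1 < m) (hx0 : 0 < x) (hx1 : x < 1) :
    ∫ ζ in (0 : ℝ)..x, ζ ^ (m - 1) * (ζ * (1 - ζ) ^ (-(1 : ℝ))) * (x ^ p - ζ ^ p) ^ (b - 1) =
      x ^ (m + 1 + p * (b - 1)) *
        ∑' n : ℕ, p⁻¹ * ProbabilityTheory.beta ((m + n + 1) / p) b * x ^ n := by
  have hn (n : ℕ) : -1 < m + n := by linarith [n.cast_nonneg (α := ℝ)]
  have hint (n : ℕ) := integrableOn_Ioo_rpow_mul_one_sub_rpow_rpow hp hb (hn n)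
  have hval (n : ℕ) := integral_Ioo_rpow_mul_one_sub_rpow_rpow hp hb (hn n)
  have hsum : Summable fun n : ℕ => p⁻¹ * ProbabilityTheory.beta ((m + n + 1) / p) b * x ^ n := by
    refine .of_nonneg_of_le (fun n => ?_) (fun n => ?_)
      ((summable_geometric_of_lt_one hx0.le hx1).mul_left
        (p⁻¹ * ProbabilityTheory.beta ((m + 1) / p) b))
    · exact mul_nonneg (beta_coeff_bounds hp hb hm n).1 (by positivity)
    · exact mul_le_mul_of_nonneg_right (beta_coeff_bounds hp hb hm n).2 (by positivity)
  have hswap := hasSum_integral_of_summable_integral_norm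
    (μ := volume.restrict (Ioo (0 : ℝ) 1))
    (F := fun (n : ℕ) (u : ℝ) => u ^ (m + n) * (1 - u ^ p) ^ (b - 1) * x ^ n)
    (fun n => (hint n).mul_const _) (by
      convert! hsum using 2 with n
      rw [← hval, ← integral_mul_const]
      refine setIntegral_congr_fun measurableSet_Ioo fun u hu => ?_
      have h1 : 0 ≤ 1 - u ^ p := sub_nonneg.2 (Real.rpow_le_one hu.1.le hu.2.le hp.le)
      exact Real.norm_of_nonneg (mul_nonneg (mul_nonneg (Real.rpow_nonneg hu.1.le _)
        (Real.rpow_nonneg h1 _)) (by positivity)))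
  simp_rw [integral_mul_const, hval] at hswap
  rw [hswap.tsum_eq]
  have hscale := intervalIntegral.smul_integral_comp_mul_left (a := 0) (b := 1)
    (fun ζ : ℝ => ζ ^ (m - 1) * (ζ * (1 - ζ) ^ (-(1 : ℝ))) * (x ^ p - ζ ^ p) ^ (b - 1)) x
  rw [mul_zero, mul_one] at hscale
  rw [← hscale, intervalIntegral.integral_of_le zero_le_one, integral_Ioc_eq_integral_Ioo,
    smul_eq_mul, ← integral_const_mul, ← integral_const_mul]
  refine setIntegral_congr_fun measurableSet_Ioo fun u hu => ?_
  have hu0 : 0 < u := hu.1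
  have h1 : 0 ≤ 1 - u ^ p := sub_nonneg.2 (Real.rpow_le_one hu.1.le hu.2.le hp.le)
  have hxu : x * u < 1 := by nlinarith [hu.2]
  have hxu0 : 0 < x * u := by positivity
  have hgeom : ∑' n : ℕ, u ^ (m + n) * (1 - u ^ p) ^ (b - 1) * x ^ n =
      u ^ m * (1 - u ^ p) ^ (b - 1) * (1 - x * u)⁻¹ := by
    rw [← tsum_geometric_of_lt_one hxu0.le hxu, ← tsum_mul_left]
    refine tsum_congr fun n => ?_
    rw [Real.rpow_add_natCast hu0.ne', mul_pow]
    ring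
  have hfac : x ^ p - (x * u) ^ p = x ^ p * (1 - u ^ p) := by
    rw [Real.mul_rpow hx0.le hu0.le]
    ring
  rw [hgeom, hfac, Real.mul_rpow (by positivity) h1, ← Real.rpow_mul hx0.le, Real.rpow_neg_one,
    Real.rpow_add hx0, Real.rpow_add_one hx0.ne', Real.mul_rpow hx0.le hu0.le,
    Real.rpow_sub_one hx0.ne', Real.rpow_sub_one hu0.ne']
  field_simp

theorem hasDerivAt_tsum_mul_pow_of_bounded {c : ℕ → ℝ} {C : ℝ} (hc : ∀ n, |c n| ≤ C) {z : ℝ}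
    (hz : |z| < 1) :
    Summable (fun n : ℕ => c n * z ^ n) ∧ Summable (fun n : ℕ => c n * (n * z ^ (n - 1))) ∧
    HasDerivAt (fun x : ℝ => ∑' n : ℕ, c n * x ^ n) (∑' n : ℕ, c n * (n * z ^ (n - 1))) z := by
  obtain ⟨r, hzr, hr1⟩ := exists_between hz
  have hr0 : 0 < r := (abs_nonneg z).trans_lt hzr
  have hC : 0 ≤ C := (abs_nonneg _).trans (hc 0)
  have hu : Summable fun n : ℕ => C * (n * r ^ (n - 1)) := by
    have h := (summable_pow_mul_geometric_of_norm_lt_one (R := ℝ) 1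
      (r := r) (by rwa [Real.norm_of_nonneg hr0.le])).mul_left (C * r⁻¹)
    refine h.congr fun n => ?_
    rcases n with _ | n
    · simp
    · simp only [Nat.add_sub_cancel, pow_succ]
      field_simp
  have hb : ∀ (n : ℕ) (y : ℝ), y ∈ Ioo (-r) r → ‖c n * (n * y ^ (n - 1))‖ ≤
      C * (n * r ^ (n - 1)) := fun n y hy => by
    rw [Real.norm_eq_abs, abs_mul, abs_mul, abs_pow, Nat.abs_cast]
    have : |y| ≤ r := (abs_lt.2 hy).le
    have := hc n
    gcongr
  have hzm : z ∈ Ioo (-r) r := abs_lt.1 hzr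
  have hs : Summable (fun n : ℕ => c n * z ^ n) := by
    refine .of_norm_bounded ((summable_geometric_of_lt_one (abs_nonneg z) hz).mul_left C)
      fun n => ?_
    rw [Real.norm_eq_abs, abs_mul, abs_pow]
    exact mul_le_mul_of_nonneg_right (hc n) (by positivity)
  exact ⟨hs, .of_norm_bounded hu fun n => hb n z hzm,
    hasDerivAt_tsum_of_isPreconnected hu isOpen_Ioo isPreconnected_Ioo
      (fun n y _ => (hasDerivAt_pow n y).const_mul (c n)) hb hzm hs hzm⟩


/-- The generalized Tremblay operator applied to the function `f(t) = t (1 - t)^{-1}`. -/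
theorem tremblay_koebe_alpha_one (γ β τ : ℝ) (hγ : 0 ≤ γ)
    (hβ0 : 0 < β) (hβ1 : β ≤ 1) (hτ0 : 0 < τ) (hτ1 : τ ≤ 1)
    (hβτ0 : 0 ≤ β - τ) (hβτ1 : β - τ < 1)
    (z : ℝ) (hz0 : 0 < z) (hz1 : z < 1) :
    ∃ F' : ℝ,
      HasDerivAt
        (fun x : ℝ => ∫ ζ in (0:ℝ)..x,
          ζ ^ (γ + β - 1) * (ζ * (1 - ζ) ^ (-(1:ℝ))) * (x ^ (γ + 1) - ζ ^ (γ + 1)) ^ (τ - β))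
        F' z ∧
      ((γ + 1) ^ (β - τ) * Real.Gamma τ) / (Real.Gamma β * Real.Gamma (1 - β + τ)) *
          z ^ (1 - τ) * F' =
        ((γ + 1) ^ (β - τ) * Real.Gamma τ) / Real.Gamma β * z ^ ((1 - β + τ) * γ) *
          ∑' κ : ℕ,
            Real.Gamma ((((κ : ℝ) + 1) + β - 1) / (γ + 1) + 1) /
              Real.Gamma ((((κ : ℝ) + 1) + β - 1) / (γ + 1) + 1 - β + τ) * z ^ (κ + 1) := by
  set p := γ + 1 with hp_def
  set b := 1 - β + τ with hb_def
  have hp : 0 < p := by linarith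
  have hb : 0 < b := by linarith
  have hm : -1 < γ + β := by linarith
  set c : ℕ → ℝ := fun n => p⁻¹ * ProbabilityTheory.beta ((γ + β + n + 1) / p) b with hc_def
  have hc : ∀ n, |c n| ≤ p⁻¹ * ProbabilityTheory.beta ((γ + β + 1) / p) b := fun n => by
    rw [abs_of_nonneg (beta_coeff_bounds hp hb hm n).1]
    exact (beta_coeff_bounds hp hb hm n).2
  obtain ⟨hs, hs', hd⟩ := hasDerivAt_tsum_mul_pow_of_bounded hc (by rwa [abs_of_pos hz0])
  have hprod := (Real.hasDerivAt_rpow_const (x := z) (p := γ + β + 1 + p * (b - 1))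
    (Or.inl hz0.ne')).mul hd
  refine ⟨_, hprod.congr_of_eventuallyEq ?_, ?_⟩
  · filter_upwards [Ioo_mem_nhds hz0 hz1] with x hx
    rw [show τ - β = b - 1 by rw [hb_def]; ring]
    exact integral_rpow_div_one_sub_mul_rpow_sub_rpow hp hb hm hx.1 hx.2
  · have hG : Real.Gamma b ≠ 0 := (Real.Gamma_pos_of_pos hb).ne'
    have hGβ : Real.Gamma β ≠ 0 := (Real.Gamma_pos_of_pos hβ0).ne'
    rw [← tsum_mul_left, ← tsum_mul_left,
      ← ((hs.mul_left _).tsum_add (hs'.mul_left _)), ← tsum_mul_left, ← tsum_mul_left]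
    refine tsum_congr fun n => ?_
    set a := ((n : ℝ) + 1 + β - 1) / p + 1 with ha_def
    have hn : (0 : ℝ) ≤ n := n.cast_nonneg
    have ha1 : 0 < a + b - 1 := by
      have : 0 ≤ ((n : ℝ) + 1 + β - 1) / p := div_nonneg (by linarith) hp.le
      linarith
    have hca : (γ + β + n + 1) / p = a := by
      rw [ha_def, hp_def]
      field_simp
      ring
    have hpa : p * (a + b - 1) = γ + β + 1 + p * (b - 1) + n := by
      rw [← hca]
      field_simp
      ring
    have hpow : (γ + β + 1 + p * (b - 1)) * z ^ (γ + β + 1 + p * (b - 1) - 1) * z ^ n +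
        z ^ (γ + β + 1 + p * (b - 1)) * (n * z ^ (n - 1)) =
        p * (a + b - 1) * (z ^ (γ + β + 1 + p * (b - 1) - 1) * z ^ n) := by
      rw [hpa]
      rcases n with _ | n
      · simp
      · rw [Real.rpow_sub_one hz0.ne', Nat.add_sub_cancel, pow_succ]
        field_simp
    have hexp : z ^ (1 - τ) * (z ^ (γ + β + 1 + p * (b - 1) - 1) * z ^ n) =
        z ^ (b * γ) * z ^ (n + 1) := by
      rw [← Real.rpow_natCast, ← Real.rpow_natCast, ← Real.rpow_add hz0, ← Real.rpow_add hz0,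
        ← Real.rpow_add hz0]
      congr 1
      push_cast
      rw [hp_def, hb_def]
      ring
    have hgam : Real.Gamma (a + b) = (a + b - 1) * Real.Gamma (a + b - 1) := by
      rw [← Real.Gamma_add_one ha1.ne', sub_add_cancel]
    have hcn : c n * (p * (a + b - 1)) =
        Real.Gamma b * (Real.Gamma a / Real.Gamma (a + b - 1)) := by
      have := (Real.Gamma_pos_of_pos ha1).ne'
      simp only [hc_def, hca, ProbabilityTheory.beta, hgam]
      field_simp
    rw [show a - β + τ = a + b - 1 by rw [hb_def]; ring]
    calc _ = p ^ (β - τ) * Real.Gamma τ / (Real.Gamma β * Real.Gamma b) * c n * z ^ (1 - τ) *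
          ((γ + β + 1 + p * (b - 1)) * z ^ (γ + β + 1 + p * (b - 1) - 1) * z ^ n +
            z ^ (γ + β + 1 + p * (b - 1)) * (n * z ^ (n - 1))) := by ring
      _ = p ^ (β - τ) * Real.Gamma τ / (Real.Gamma β * Real.Gamma b) * (c n * (p * (a + b - 1))) *
          (z ^ (1 - τ) * (z ^ (γ + β + 1 + p * (b - 1) - 1) * z ^ n)) := by rw [hpow]; ring
      _ = _ := by
        rw [hexp, hcn]
        field_simp
end
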